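/- arXiv:2411.17419 — 2 statements merged into one kernel-verified Lean document; each statement's English description precedes it below -/
import Mathlib

section
/- Let α_R, α_F ∈ [0,1), let R be the real 2×2 matrix with rows (1, −α_R) and (−α_F, 1), let T_D : ℝ ⇒ ℝ be monotone and outer semicontinuous (its graph is closed in ℝ × ℝ), define T_NPN : ℝ² ⇒ ℝ² by T_NPN(v₁,v₂) := {R·(u₁,u₂) : u₁ ∈ T_D(v₁), u₂ ∈ T_D(v₂)}, fix r > 0 and a target current i ∈ ℝ², and define T̃(v) := T_NPN(v) + (1/r)·v − i. Let γ > r(√2 − 1) and let (v^k)_{k∈ℕ} be a sequence in ℝ² satisfying the proximal point update v^{k+1} ∈ J_{γT̃}(v^k) for all k, where J_{γT̃} := (id + γ·T̃)⁻¹. Then (v^k) converges to a point v* satisfying 0 ∈ T̃(v*), i.e., i ∈ T_NPN(v*) + (1/r)·v*. -/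
open Filter Topology

/-- If `p ^ 2 ≤ q ^ 2` and `0 ≤ q * z`, the comonotonicity quadratic form is
nonnegative. -/
lemma comonotone_form_nonneg_of_dominated {p q y z : ℝ} (hpq : p ^ 2 ≤ q ^ 2) (hqz : 0 ≤ q * z) :
    0 ≤ (p + y) * y + (q + z) * z + (√2 - 1) / 2 * ((p + y) ^ 2 + (q + z) ^ 2) := by
  have hs : √2 ^ 2 = 2 := Real.sq_sqrt (by norm_num)
  have hs1 : 1 ≤ √2 := Real.one_le_sqrt.mpr (by norm_num)
  have h1 : 0 ≤ (√2 - 1) * (q ^ 2 - p ^ 2) := mul_nonneg (by linarith) (by linarith)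
  have h2 : 0 ≤ √2 * (q * z) := by positivity
  have h3 : 0 ≤ (1 + √2) * z ^ 2 := by positivity
  have h4 : 0 ≤ (√2 - 1) * ((1 + √2) * y + √2 * p) ^ 2 := mul_nonneg (by linarith) (sq_nonneg _)
  have h5 : (√2 - 1) * ((1 + √2) * y + √2 * p) ^ 2
      = (1 + √2) * y ^ 2 + 2 * √2 * (p * y) + 2 * (√2 - 1) * p ^ 2 := by
    linear_combination (y ^ 2 * (√2 + 1) + 2 * y * p * √2 + (√2 - 1) * p ^ 2) * hs
  nlinarith

lemma sq_le_sq_of_mul_neg {A B a b y z : ℝ} (hA : A ∈ Set.Ico (0 : ℝ) 1)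
    (hB : B ∈ Set.Ico (0 : ℝ) 1) (ha : 0 ≤ a * y) (hb : 0 ≤ b * z) (h : (a - A * b) * y < 0) :
    (a - A * b) ^ 2 ≤ (b - B * a) ^ 2 ∧ 0 ≤ (b - B * a) * z := by
  obtain ⟨hA0, hA1⟩ := hA
  obtain ⟨hB0, hB1⟩ := hB
  have key : ∀ {a b y z : ℝ}, 0 < y → 0 ≤ a * y → 0 ≤ b * z → (a - A * b) * y < 0 →
      (a - A * b) ^ 2 ≤ (b - B * a) ^ 2 ∧ 0 ≤ (b - B * a) * z := by
    intro a b y z hy ha hb h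
    have ha0 : 0 ≤ a := nonneg_of_mul_nonneg_left ha hy
    have hp : a - A * b < 0 := by
      by_contra hc
      exact absurd (mul_nonneg (not_lt.mp hc) hy.le) (not_le.mpr h)
    have hb0 : 0 < b := pos_of_mul_pos_right (by linarith : 0 < A * b) hA0
    have hz : 0 ≤ z := nonneg_of_mul_nonneg_right hb hb0
    have hq : -(a - A * b) ≤ b - B * a := by nlinarith
    exact ⟨by nlinarith, mul_nonneg (by linarith) hz⟩
  rcases lt_trichotomy y 0 with hy | hy | hy
  · have := key (a := -a) (b := -b) (y := -y) (z := -z) (by linarith) (by linarith) (by linarith)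
      (by linarith)
    exact ⟨by linarith [this.1], by linarith [this.2]⟩
  · simp [hy] at h
  · exact key hy ha hb h

/-- Comonotonicity of the regularised Ebers–Moll operator, in coordinates. -/
lemma ebersMoll_comonotone {A B a b y z : ℝ} (hA : A ∈ Set.Ico (0 : ℝ) 1)
    (hB : B ∈ Set.Ico (0 : ℝ) 1) (ha : 0 ≤ a * y) (hb : 0 ≤ b * z) :
    0 ≤ (a - A * b + y) * y + (b - B * a + z) * z
      + (√2 - 1) / 2 * ((a - A * b + y) ^ 2 + (b - B * a + z) ^ 2) := by
  rcases lt_or_ge ((a - A * b) * y) 0 with hy | hy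
  · obtain ⟨h1, h2⟩ := sq_le_sq_of_mul_neg hA hB ha hb hy
    exact comonotone_form_nonneg_of_dominated h1 h2
  rcases lt_or_ge ((b - B * a) * z) 0 with hz | hz
  · obtain ⟨h1, h2⟩ := sq_le_sq_of_mul_neg hB hA hb ha hz
    linarith [comonotone_form_nonneg_of_dominated (y := z) h1 h2]
  · have hs1 : 1 ≤ √2 := Real.one_le_sqrt.mpr (by norm_num)
    have h1 : 0 ≤ (√2 - 1) / 2 * ((a - A * b + y) ^ 2 + (b - B * a + z) ^ 2) :=
      mul_nonneg (by linarith) (by positivity)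
    nlinarith [sq_nonneg y, sq_nonneg z]

/-- Expansiveness of the regularised Ebers–Moll operator in the `ℓ¹` norm. -/
lemma ebersMoll_expansive {A B a b y z : ℝ} (hA : 0 ≤ A) (hB : 0 ≤ B)
    (ha : 0 ≤ a * y) (hb : 0 ≤ b * z) :
    (1 - B) * |a| + (1 - A) * |b| + |y| + |z| ≤ |a - A * b + y| + |b - B * a + z| := by
  have key : ∀ {C c d x : ℝ}, 0 ≤ C → 0 ≤ c * x → |c| + |x| ≤ |c - C * d + x| + C * |d| := by
    intro C c d x hC h
    calc |c| + |x| = |c + x| := ((abs_add_eq_add_abs_iff c x).mpr (mul_nonneg_iff.mp h)).symm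
      _ = |(c - C * d + x) + C * d| := by ring_nf
      _ ≤ |c - C * d + x| + |C * d| := abs_add_le _ _
      _ = |c - C * d + x| + C * |d| := by rw [abs_mul, abs_of_nonneg hC]
  linarith [key (d := b) hA ha, key (d := a) hB hb]

lemma exists_tendsto_of_dominated {x f g : ℕ → ℝ} {C : ℝ}
    (hf : Tendsto f atTop (𝓝 0)) (hg : Tendsto g atTop (𝓝 0))
    (h : ∀ m n, |x m - x n| ≤ C * (|f m - f n| + |g m - g n|)) :
    ∃ l, Tendsto x atTop (𝓝 l) := by
  apply cauchySeq_tendsto_of_complete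
  rw [cauchySeq_iff_tendsto_dist_atTop_0]
  have h1 : Tendsto (fun n : ℕ × ℕ => n.1) atTop atTop := by
    rw [← prod_atTop_atTop_eq]; exact tendsto_fst
  have h2 : Tendsto (fun n : ℕ × ℕ => n.2) atTop atTop := by
    rw [← prod_atTop_atTop_eq]; exact tendsto_snd
  have hlim := ((((hf.comp h1).sub (hf.comp h2)).abs).add
    (((hg.comp h1).sub (hg.comp h2)).abs)).const_mul C
  simp only [sub_zero, abs_zero, add_zero, mul_zero] at hlim
  exact squeeze_zero (fun _ => dist_nonneg) (fun n => by rw [Real.dist_eq]; exact h n.1 n.2) hlim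

lemma tendsto_zero_of_mul_le {N : ℕ → ℝ} {q : ℝ} (hq : 1 < q) (hN : ∀ k, 0 ≤ N k)
    (h : ∀ k, q * N (k + 1) ≤ N k) : Tendsto N atTop (𝓝 0) := by
  have hq0 : 0 < q := by linarith
  have hb : ∀ k, N k ≤ q⁻¹ ^ k * N 0 := by
    intro k
    induction k with
    | zero => simp
    | succ k ih =>
      have h1 : N (k + 1) ≤ q⁻¹ * N k := by
        rw [inv_mul_eq_div, le_div_iff₀ hq0]; linarith [h k]
      calc N (k + 1) ≤ q⁻¹ * N k := h1
        _ ≤ q⁻¹ * (q⁻¹ ^ k * N 0) := by gcongr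
        _ = q⁻¹ ^ (k + 1) * N 0 := by ring
  have hlim := (tendsto_pow_atTop_nhds_zero_of_lt_one (inv_nonneg.mpr hq0.le)
    (inv_lt_one_of_one_lt₀ hq)).mul_const (N 0)
  rw [zero_mul] at hlim
  exact squeeze_zero hN hb hlim


/-- The Ebers–Moll matrix with rows `(1, -αR)` and `(-αF, 1)`, applied to a vector of
`ℝ²` (with the Euclidean inner product and norm). -/
noncomputable def applyEM (aR aF : ℝ) (w : EuclideanSpace ℝ (Fin 2)) :
    EuclideanSpace ℝ (Fin 2) :=
  (WithLp.equiv 2 (Fin 2 → ℝ)).symm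
    ((Matrix.of ![![1, -aR], ![-aF, 1]]).mulVec (WithLp.equiv 2 (Fin 2 → ℝ) w))

/-- A set-valued operator `T_D : ℝ ⇒ ℝ` is monotone if `(u - v)(x - y) ≥ 0` whenever
`u ∈ T_D(x)` and `v ∈ T_D(y)`. -/
def MonotoneSetValued (TD : ℝ → Set ℝ) : Prop :=
  ∀ ⦃x u y v : ℝ⦄, u ∈ TD x → v ∈ TD y → (u - v) * (x - y) ≥ 0

/-- The Ebers–Moll transistor operator `T_NPN : ℝ² ⇒ ℝ²` built from the diode law `T_D`. -/
noncomputable def TNPN (aR aF : ℝ) (TD : ℝ → Set ℝ) (v : EuclideanSpace ℝ (Fin 2)) :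
    Set (EuclideanSpace ℝ (Fin 2)) :=
  {w | ∃ u₁ ∈ TD (v 0), ∃ u₂ ∈ TD (v 1),
    w = applyEM aR aF ((WithLp.equiv 2 (Fin 2 → ℝ)).symm ![u₁, u₂])}

theorem stmt_17 (aR aF : ℝ) (haR : aR ∈ Set.Ico (0 : ℝ) 1) (haF : aF ∈ Set.Ico (0 : ℝ) 1)
    (TD : ℝ → Set ℝ) (hTD : MonotoneSetValued TD)
    (hTDosc : IsClosed {p : ℝ × ℝ | p.2 ∈ TD p.1})
    (r : ℝ) (hr : r > 0) (i : EuclideanSpace ℝ (Fin 2))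
    -- `T̃(v) := T_NPN(v) + (1/r)·v − i`
    (Ttil : EuclideanSpace ℝ (Fin 2) → Set (EuclideanSpace ℝ (Fin 2)))
    (hTtil : ∀ v, Ttil v = (fun w => w + (1 / r) • v - i) '' TNPN aR aF TD v)
    (γ : ℝ) (hγ : γ > r * (Real.sqrt 2 - 1))
    (v : ℕ → EuclideanSpace ℝ (Fin 2))
    -- `v^{k+1} ∈ J_{γT̃}(v^k)`, i.e. `v^k ∈ v^{k+1} + γ·T̃(v^{k+1})`
    (hppa : ∀ k : ℕ, ∃ w ∈ Ttil (v (k + 1)), v k = v (k + 1) + γ • w) :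
    ∃ vstar : EuclideanSpace ℝ (Fin 2),
      Filter.Tendsto v Filter.atTop (nhds vstar) ∧ (0 : EuclideanSpace ℝ (Fin 2)) ∈ Ttil vstar := by
  have hs1 : 1 ≤ √2 := Real.one_le_sqrt.mpr (by norm_num)
  have hγ0 : 0 < γ := lt_of_le_of_lt (mul_nonneg hr.le (by linarith)) hγ
  have hex : ∀ k : ℕ, ∃ w : EuclideanSpace ℝ (Fin 2), ∃ a ∈ TD (v (k + 1) 0),
      ∃ b ∈ TD (v (k + 1) 1), w 0 = a - aR * b + v (k + 1) 0 / r - i 0 ∧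
        w 1 = b - aF * a + v (k + 1) 1 / r - i 1 ∧
        v k 0 = v (k + 1) 0 + γ * w 0 ∧ v k 1 = v (k + 1) 1 + γ * w 1 := by
    intro k
    obtain ⟨w, hw, hv⟩ := hppa k
    rw [hTtil] at hw
    obtain ⟨t, ⟨a, ha, b, hb, rfl⟩, rfl⟩ := hw
    refine ⟨applyEM aR aF ((WithLp.equiv 2 (Fin 2 → ℝ)).symm ![a, b]) + (1 / r) • v (k + 1) - i,
      a, ha, b, hb, ?_, ?_, congrArg (fun x => x.ofLp 0) hv,
      congrArg (fun x => x.ofLp 1) hv⟩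
    · simp [applyEM]; ring
    · simp [applyEM]; ring
  choose w a ha b hb hw0 hw1 hv0 hv1 using hex
  have hay : ∀ m n, 0 ≤ (a m - a n) * ((v (m + 1) 0 - v (n + 1) 0) / r) := fun m n => by
    rw [← mul_div_assoc]; exact div_nonneg (hTD (ha m) (ha n)) hr.le
  have hbz : ∀ m n, 0 ≤ (b m - b n) * ((v (m + 1) 1 - v (n + 1) 1) / r) := fun m n => by
    rw [← mul_div_assoc]; exact div_nonneg (hTD (hb m) (hb n)) hr.le
  have hd0 : ∀ m n, a m - a n - aR * (b m - b n) + (v (m + 1) 0 - v (n + 1) 0) / r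
      = w m 0 - w n 0 := fun m n => by rw [hw0, hw0]; ring
  have hd1 : ∀ m n, b m - b n - aF * (a m - a n) + (v (m + 1) 1 - v (n + 1) 1) / r
      = w m 1 - w n 1 := fun m n => by rw [hw1, hw1]; ring
  have hexp : ∀ m n, (1 - aF) * |a m - a n| + (1 - aR) * |b m - b n|
      + |(v (m + 1) 0 - v (n + 1) 0) / r| + |(v (m + 1) 1 - v (n + 1) 1) / r|
      ≤ |w m 0 - w n 0| + |w m 1 - w n 1| := fun m n => by
    rw [← hd0, ← hd1]; exact ebersMoll_expansive haR.1 haF.1 (hay m n) (hbz m n)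
  have hcom : ∀ m n, 0 ≤ (w m 0 - w n 0) * ((v (m + 1) 0 - v (n + 1) 0) / r)
      + (w m 1 - w n 1) * ((v (m + 1) 1 - v (n + 1) 1) / r)
      + (√2 - 1) / 2 * ((w m 0 - w n 0) ^ 2 + (w m 1 - w n 1) ^ 2) := fun m n => by
    rw [← hd0, ← hd1]; exact ebersMoll_comonotone haR haF (hay m n) (hbz m n)
  have hpA : 0 < 1 - aR := by linarith [haR.2]
  have hpB : 0 < 1 - aF := by linarith [haF.2]
  set g : ℝ := γ / r with hg
  have hg0 : 0 < g := by positivity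
  have hgs : √2 - 1 < g := by rw [hg, lt_div_iff₀ hr]; linarith
  have hdec : ∀ k, (1 + (g - (√2 - 1)) * g / 2) * (w (k + 1) 0 ^ 2 + w (k + 1) 1 ^ 2)
      ≤ w k 0 ^ 2 + w k 1 ^ 2 := by
    intro k
    have e0 : (v (k + 1) 0 - v (k + 1 + 1) 0) / r = g * w (k + 1) 0 := by
      rw [hv0 (k + 1)]; ring
    have e1 : (v (k + 1) 1 - v (k + 1 + 1) 1) / r = g * w (k + 1) 1 := by
      rw [hv1 (k + 1)]; ring
    have hc := hcom k (k + 1)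
    have he := hexp k (k + 1)
    rw [e0, e1] at hc he
    rw [abs_mul, abs_mul, abs_of_pos hg0] at he
    have p1 := mul_nonneg hpB.le (abs_nonneg (a k - a (k + 1)))
    have p2 := mul_nonneg hpA.le (abs_nonneg (b k - b (k + 1)))
    generalize w k 0 = s at *
    generalize w k 1 = t at *
    generalize w (k + 1) 0 = x at *
    generalize w (k + 1) 1 = y at *
    have hle : g * (|x| + |y|) ≤ |s - x| + |t - y| := by linarith
    have hsq : g ^ 2 * (x ^ 2 + y ^ 2) ≤ 2 * ((s - x) ^ 2 + (t - y) ^ 2) := by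
      have h1 : (g * (|x| + |y|)) ^ 2 ≤ (|s - x| + |t - y|) ^ 2 := by gcongr
      have h2 : (|s - x| + |t - y|) ^ 2 ≤ 2 * ((s - x) ^ 2 + (t - y) ^ 2) := by
        rw [← sq_abs (s - x), ← sq_abs (t - y)]; exact add_sq_le
      have h3 : x ^ 2 + y ^ 2 ≤ (|x| + |y|) ^ 2 := by
        nlinarith [sq_abs x, sq_abs y, mul_nonneg (abs_nonneg x) (abs_nonneg y)]
      nlinarith [mul_le_mul_of_nonneg_left h3 (sq_nonneg g)]
    have h4 := mul_le_mul_of_nonneg_left hsq (sub_nonneg.mpr hgs.le)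
    refine le_of_mul_le_mul_left ?_ hg0
    linarith
  have hN := tendsto_zero_of_mul_le (N := fun k => w k 0 ^ 2 + w k 1 ^ 2)
    (by linarith [mul_pos (sub_pos.mpr hgs) hg0]) (fun k => by positivity) hdec
  have hsqrt := hN.sqrt
  rw [Real.sqrt_zero] at hsqrt
  have hW0 : Tendsto (fun k => w k 0) atTop (𝓝 0) :=
    squeeze_zero_norm (fun k => Real.abs_le_sqrt (by linarith [sq_nonneg (w k 1)])) hsqrt
  have hW1 : Tendsto (fun k => w k 1) atTop (𝓝 0) :=
    squeeze_zero_norm (fun k => Real.abs_le_sqrt (by linarith [sq_nonneg (w k 0)])) hsqrt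
  have hparts : ∀ m n, 0 ≤ (1 - aF) * |a m - a n| ∧ 0 ≤ (1 - aR) * |b m - b n| ∧
      0 ≤ |(v (m + 1) 0 - v (n + 1) 0) / r| ∧ 0 ≤ |(v (m + 1) 1 - v (n + 1) 1) / r| :=
    fun m n => ⟨by positivity, by positivity, by positivity, by positivity⟩
  obtain ⟨la, hla⟩ : ∃ l, Tendsto a atTop (𝓝 l) :=
    exists_tendsto_of_dominated (C := (1 - aF)⁻¹) hW0 hW1 fun m n => by
      rw [inv_mul_eq_div, le_div_iff₀ hpB]
      linarith [hexp m n, hparts m n]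
  obtain ⟨lb, hlb⟩ : ∃ l, Tendsto b atTop (𝓝 l) :=
    exists_tendsto_of_dominated (C := (1 - aR)⁻¹) hW0 hW1 fun m n => by
      rw [inv_mul_eq_div, le_div_iff₀ hpA]
      linarith [hexp m n, hparts m n]
  obtain ⟨x, hx⟩ : ∃ l, Tendsto (fun k => v (k + 1) 0) atTop (𝓝 l) :=
    exists_tendsto_of_dominated (C := r) hW0 hW1 fun m n => by
      rw [mul_comm r, ← div_le_iff₀ hr, ← abs_of_pos hr, ← abs_div]
      linarith [hexp m n, hparts m n]
  obtain ⟨y, hy⟩ : ∃ l, Tendsto (fun k => v (k + 1) 1) atTop (𝓝 l) :=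
    exists_tendsto_of_dominated (C := r) hW0 hW1 fun m n => by
      rw [mul_comm r, ← div_le_iff₀ hr, ← abs_of_pos hr, ← abs_div]
      linarith [hexp m n, hparts m n]
  have hxa : la ∈ TD x :=
    hTDosc.mem_of_tendsto (hx.prodMk_nhds hla) (Eventually.of_forall ha)
  have hyb : lb ∈ TD y :=
    hTDosc.mem_of_tendsto (hy.prodMk_nhds hlb) (Eventually.of_forall hb)
  have hz0 : la - aR * lb + x / r - i 0 = 0 := by
    refine tendsto_nhds_unique ?_ hW0
    simp only [hw0]
    exact ((hla.sub (hlb.const_mul aR)).add (hx.div_const r)).sub_const _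
  have hz1 : lb - aF * la + y / r - i 1 = 0 := by
    refine tendsto_nhds_unique ?_ hW1
    simp only [hw1]
    exact ((hlb.sub (hla.const_mul aF)).add (hy.div_const r)).sub_const _
  refine ⟨!₂[x, y], ?_, ?_⟩
  · rw [← tendsto_add_atTop_iff_nat 1]
    have hpi : Tendsto (fun k => (v (k + 1)).ofLp) atTop (𝓝 ![x, y]) := by
      rw [tendsto_pi_nhds]
      intro j
      fin_cases j
      · exact hx
      · exact hy
    exact ((PiLp.continuous_toLp 2 (fun _ : Fin 2 => ℝ)).tendsto _).comp hpi
  · rw [hTtil]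
    refine ⟨_, ⟨la, by simpa using hxa, lb, by simpa using hyb, rfl⟩, ?_⟩
    ext j
    fin_cases j
    · simp [applyEM]; linear_combination hz0
    · simp [applyEM]; linear_combination hz1
end

section
/- Consider the common-emitter amplifier inclusion: find (i, v) ∈ ℝ² × ℝ² with 0 ∈ R̃(i) + v and 0 ∈ G̃(v) − i, where R̃(i₁,i₂) := (R_C(i₁) + s₁, R_E(i₂) + s₂) for outer semicontinuous functions R_C, R_E : ℝ → ℝ and a fixed source vector s = (s₁,s₂) ∈ ℝ², and G̃ := T_NPN + (1/r)·id for the Ebers–Moll operator T_NPN built from α_R, α_F ∈ [0,1) and a monotone, outer semicontinuous T_D : ℝ ⇒ ℝ, with leakage resistance r > 0. Suppose R_C and R_E are σ-monotone with σ > r(√2 − 1)/2, and let the stepsizes satisfy τ ∈ (τ̲, ∞) with τ̲ := −σr(1 − √2)/(r(1 − √2) + 2σ), γ ∈ (0, 1/τ), and λ ∈ (0, 2(1 − τ̲/τ)). Then any sequence (i^k, v^k)_{k∈ℕ} generated by the Chambolle–Pock iteration ī^k ∈ J_{γR̃}(i^k − γ v^k), v̄^k ∈ J_{τG̃}(v^k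 + τ(2ī^k − i^k)), i^{k+1} = i^k + λ(ī^k − i^k), v^{k+1} = v^k + λ(v̄^k − v^k) converges to a solution (i*, v*) of the inclusion. -/
/-- `T_NPN + (1/r)·id`, the transistor with leakage resistance `r`. -/
noncomputable def TNPNr (aR aF : ℝ) (TD : ℝ → Set ℝ) (r : ℝ)
    (v : EuclideanSpace ℝ (Fin 2)) : Set (EuclideanSpace ℝ (Fin 2)) :=
  (fun w => w + (1 / r) • v) '' TNPN aR aF TD v

open scoped InnerProductSpace

section ChambollePock

variable {E : Type*} [NormedAddCommGroup E] [InnerProductSpace ℝ E]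

/-- The quadratic form of the Chambolle–Pock preconditioner with stepsizes `γ` and `τ`. -/
noncomputable def cpForm (γ τ : ℝ) (x y : E) : ℝ :=
  ‖x‖ ^ 2 / γ - 2 * ⟪x, y⟫_ℝ + ‖y‖ ^ 2 / τ

lemma cpForm_eq_left (γ : ℝ) {τ : ℝ} (hτ : τ ≠ 0) (x y : E) :
    cpForm γ τ x y = τ * ‖τ⁻¹ • y - x‖ ^ 2 + (1 / γ - τ) * ‖x‖ ^ 2 := by
  rw [cpForm, norm_sub_sq_real, norm_smul, inner_smul_left, real_inner_comm, mul_pow,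
    Real.norm_eq_abs, sq_abs]
  simp only [RCLike.conj_to_real]
  field_simp
  ring

lemma cpForm_eq_right {γ : ℝ} (hγ : γ ≠ 0) (τ : ℝ) (x y : E) :
    cpForm γ τ x y = γ * ‖γ⁻¹ • x - y‖ ^ 2 + (1 / τ - γ) * ‖y‖ ^ 2 := by
  rw [← cpForm_eq_left τ hγ, cpForm, cpForm, real_inner_comm]
  ring

lemma cpForm_sub_smul (γ τ lam : ℝ) (x y dx dy : E) :
    cpForm γ τ (x - lam • dx) (y - lam • dy) = cpForm γ τ x y
      - 2 * lam * (⟪x, γ⁻¹ • dx - dy⟫_ℝ + ⟪y, τ⁻¹ • dy - dx⟫_ℝ)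
      + lam ^ 2 * cpForm γ τ dx dy := by
  simp only [cpForm, ← real_inner_self_eq_norm_sq, inner_sub_left, inner_sub_right,
    inner_smul_left, inner_smul_right, RCLike.conj_to_real, real_inner_comm x, real_inner_comm y dx,
    real_inner_comm y dy]
  ring

lemma norm_add_sq_le_two_mul (a b : E) : ‖a + b‖ ^ 2 ≤ 2 * (‖a‖ ^ 2 + ‖b‖ ^ 2) := by
  have h := parallelogram_law_with_norm ℝ a b
  have := mul_self_nonneg ‖a - b‖
  simp only [sq]
  linarith

lemma norm_smul_add_sub_sq_le {τ : ℝ} (hτ : 0 < τ) (y q x : E) :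
    ‖τ⁻¹ • y + (q - x)‖ ^ 2 ≤ 3 * (‖y‖ ^ 2 / τ ^ 2 + ‖q‖ ^ 2 + ‖x‖ ^ 2) := by
  have h : ‖τ⁻¹ • y + (q - x)‖ ≤ ‖y‖ / τ + ‖q‖ + ‖x‖ := by
    refine (norm_add_le _ _).trans ?_
    rw [norm_smul, Real.norm_eq_abs, abs_of_pos (inv_pos.2 hτ), inv_mul_eq_div]
    linarith [norm_sub_le q x]
  refine (pow_le_pow_left₀ (norm_nonneg _) h 2).trans ?_
  rw [← div_pow]
  linarith [sq_nonneg (‖y‖ / τ - ‖q‖), sq_nonneg (‖y‖ / τ - ‖x‖), sq_nonneg (‖q‖ - ‖x‖)]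

lemma cpForm_add_le {γ τ L : ℝ} (hτ : 0 < τ) (hγτ : τ ≤ 1 / γ) (hL : 0 ≤ L)
    {x y dx dy q : E} (hq : τ⁻¹ • dy - dx = q) (hy : ‖y‖ ^ 2 ≤ L * ‖q + x‖ ^ 2) :
    cpForm γ τ (x + dx) (y + dy) ≤
      (τ * (3 + 6 * L / τ ^ 2) + 2 * (1 / γ - τ)) * (‖q‖ ^ 2 + ‖dx‖ ^ 2 + ‖x‖ ^ 2) := by
  have hγτ' : 0 ≤ 1 / γ - τ := sub_nonneg.2 hγτ
  have e0 : τ⁻¹ • (y + dy) - (x + dx) = τ⁻¹ • y + (q - x) := by rw [← hq]; module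
  have e1 := norm_smul_add_sub_sq_le hτ y q x
  have e2 : ‖y‖ ^ 2 ≤ L * (2 * (‖q‖ ^ 2 + ‖x‖ ^ 2)) :=
    hy.trans (mul_le_mul_of_nonneg_left (norm_add_sq_le_two_mul q x) hL)
  have e3 : ‖y‖ ^ 2 / τ ^ 2 ≤ L / τ ^ 2 * (2 * (‖q‖ ^ 2 + ‖x‖ ^ 2)) := by
    rw [div_mul_eq_mul_div]
    gcongr
  rw [cpForm_eq_left γ hτ.ne', e0, add_mul]
  refine add_le_add ?_ ?_
  · rw [mul_assoc]
    refine mul_le_mul_of_nonneg_left ?_ hτ.le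
    have e4 : 0 ≤ L / τ ^ 2 * ‖dx‖ ^ 2 := by positivity
    rw [mul_div_assoc]
    linarith [sq_nonneg ‖dx‖]
  · have := mul_le_mul_of_nonneg_left (norm_add_sq_le_two_mul x dx) hγτ'
    have := mul_nonneg hγτ' (sq_nonneg ‖q‖)
    linarith

/-- The relaxation bound leaves room for a modulus `β'` slightly larger than `σμ/(σ - μ)`. -/
lemma exists_comonotonicity_slack {τ lam σ μ : ℝ} (hμ : 0 < μ) (hσ : μ < σ) (hτ : 0 < τ)
    (hlam : lam < 2 * (1 - σ * μ / (σ - μ) / τ)) :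
    ∃ β η : ℝ, β < (2 - lam) * τ / 2 ∧ 0 < η ∧ 0 < σ - μ - η ∧ η * (β - μ) = μ ^ 2 := by
  have hσμ : 0 < σ - μ := sub_pos.2 hσ
  have hββ : (σ * μ / (σ - μ) - μ) * (σ - μ) = μ ^ 2 := by field_simp; ring
  have hβμ : 0 < σ * μ / (σ - μ) - μ :=
    pos_of_mul_pos_left (hββ ▸ pow_pos hμ 2) hσμ.le
  have h2 : σ * μ / (σ - μ) < (2 - lam) * τ / 2 := by
    have : σ * μ / (σ - μ) / τ < (2 - lam) / 2 := by linarith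
    rw [div_lt_iff₀ hτ] at this
    linarith
  obtain ⟨β, h1, h2⟩ := exists_between h2
  have hβ : 0 < β - μ := by linarith
  refine ⟨β, μ ^ 2 / (β - μ), h2, by positivity, ?_, by field_simp⟩
  rw [sub_pos, div_lt_iff₀ hβ, ← hββ, mul_comm]
  exact mul_lt_mul_of_pos_left (by linarith) hσμ

/-- One Chambolle–Pock step applied to two points contracts the preconditioner form of their
difference, if the first operator is `σ`-monotone and the inverse of the second is Lipschitz
and `-μ`-monotone with `μ < σ`. -/
lemma exists_cpForm_contraction {γ τ lam σ μ L : ℝ} (hμ : 0 < μ) (hσ : μ < σ) (hL : 0 ≤ L)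
    (hτ : 0 < τ) (hγτ : τ < 1 / γ) (hlam : 0 < lam)
    (hlam' : lam < 2 * (1 - σ * μ / (σ - μ) / τ)) :
    ∃ κ : ℝ, 0 ≤ κ ∧ κ < 1 ∧ ∀ x y xb yb ρ g : E,
      γ⁻¹ • (x - xb) - (y - yb) = ρ + yb → τ⁻¹ • (y - yb) - (x - xb) = g - xb →
      σ * ‖xb‖ ^ 2 ≤ ⟪xb, ρ⟫_ℝ → -μ * ‖g‖ ^ 2 ≤ ⟪yb, g⟫_ℝ → ‖yb‖ ^ 2 ≤ L * ‖g‖ ^ 2 →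
      cpForm γ τ (x + lam • (xb - x)) (y + lam • (yb - y)) ≤ κ * cpForm γ τ x y := by
  obtain ⟨β', η, h2', hη0, hε, hηe⟩ := exists_comonotonicity_slack hμ hσ hτ hlam'
  have hl2 : 0 < 2 - lam := by
    have : 0 ≤ σ * μ / (σ - μ) / τ :=
      div_nonneg (div_nonneg (mul_pos (hμ.trans hσ) hμ).le (sub_pos.2 hσ).le) hτ.le
    linarith
  set c := min (min ((2 - lam) * τ - 2 * β') ((2 - lam) * (1 / γ - τ))) (2 * (σ - μ - η)) with hc
  have hc0 : 0 < c := by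
    refine lt_min (lt_min (by linarith) (mul_pos hl2 (by linarith))) (by linarith)
  have hc1 : c ≤ (2 - lam) * τ - 2 * β' := (min_le_left _ _).trans (min_le_left _ _)
  have hc2 : c ≤ (2 - lam) * (1 / γ - τ) := (min_le_left _ _).trans (min_le_right _ _)
  have hc3 : c ≤ 2 * (σ - μ - η) := min_le_right _ _
  set K := τ * (3 + 6 * L / τ ^ 2) + 2 * (1 / γ - τ) with hK
  have hK0 : 0 < K := by
    have : 0 < 1 / γ - τ := by linarith
    positivity
  refine ⟨max 0 (1 - lam * c / K), le_max_left _ _,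
    max_lt one_pos (by have : 0 < lam * c / K := by positivity
                       linarith), ?_⟩
  intro x y xb yb ρ g hp hq hρ hg hyb
  obtain ⟨dx, rfl⟩ : ∃ dx, x = xb + dx := ⟨x - xb, by abel⟩
  obtain ⟨dy, rfl⟩ : ∃ dy, y = yb + dy := ⟨y - yb, by abel⟩
  simp only [add_sub_cancel_left] at hp hq
  obtain ⟨q, rfl⟩ : ∃ q, g = q + xb := ⟨g - xb, by abel⟩
  rw [add_sub_cancel_right] at hq
  have hx' : xb + dx + lam • (xb - (xb + dx)) = xb + dx - lam • dx := by module
  have hy' : yb + dy + lam • (yb - (yb + dy)) = yb + dy - lam • dy := by module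
  have hQd : cpForm γ τ dx dy = τ * ‖q‖ ^ 2 + (1 / γ - τ) * ‖dx‖ ^ 2 := by
    rw [cpForm_eq_left γ hτ.ne', hq]
  have hB : ⟪xb + dx, γ⁻¹ • dx - dy⟫_ℝ + ⟪yb + dy, τ⁻¹ • dy - dx⟫_ℝ =
      cpForm γ τ dx dy + ⟪xb, ρ⟫_ℝ + ⟪yb, q + xb⟫_ℝ := by
    rw [inner_add_left, inner_add_left, hp, hq, inner_add_right xb, inner_add_right yb,
      real_inner_comm xb yb, ← hp, ← hq]
    simp only [cpForm, ← real_inner_self_eq_norm_sq, inner_sub_right, inner_smul_right,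
      real_inner_comm dx dy]
    ring
  have hmon : (σ - μ - η) * ‖xb‖ ^ 2 - β' * ‖q‖ ^ 2 ≤ ⟪xb, ρ⟫_ℝ + ⟪yb, q + xb⟫_ℝ := by
    rw [norm_add_sq_real] at hg
    have hsq : 0 ≤ ‖η • xb - μ • q‖ ^ 2 := by positivity
    rw [norm_sub_sq_real, norm_smul, norm_smul, inner_smul_left, inner_smul_right,
      real_inner_comm, mul_pow, mul_pow, Real.norm_eq_abs, Real.norm_eq_abs, sq_abs, sq_abs] at hsq
    simp only [RCLike.conj_to_real] at hsq
    have hsq' : 0 ≤ η * (η * ‖xb‖ ^ 2 - 2 * μ * ⟪q, xb⟫_ℝ + (β' - μ) * ‖q‖ ^ 2) := by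
      refine hsq.trans_eq ?_
      rw [← hηe]
      ring
    have := nonneg_of_mul_nonneg_right hsq' hη0
    linarith
  have hdesc : cpForm γ τ (xb + dx - lam • dx) (yb + dy - lam • dy) ≤
      cpForm γ τ (xb + dx) (yb + dy) - lam * c * (‖q‖ ^ 2 + ‖dx‖ ^ 2 + ‖xb‖ ^ 2) := by
    rw [cpForm_sub_smul, hB, hQd]
    have e1 := mul_le_mul_of_nonneg_right hc1 (sq_nonneg ‖q‖)
    have e2 := mul_le_mul_of_nonneg_right hc2 (sq_nonneg ‖dx‖)
    have e3 := mul_le_mul_of_nonneg_right hc3 (sq_nonneg ‖xb‖)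
    have := mul_le_mul_of_nonneg_left (add_le_add (add_le_add e1 e2) e3) hlam.le
    have := mul_le_mul_of_nonneg_left hmon hlam.le
    linarith
  have hbound : cpForm γ τ (xb + dx) (yb + dy) ≤ K * (‖q‖ ^ 2 + ‖dx‖ ^ 2 + ‖xb‖ ^ 2) :=
    cpForm_add_le hτ hγτ.le hL hq hyb
  have hQ0 : 0 ≤ cpForm γ τ (xb + dx) (yb + dy) := by
    rw [cpForm_eq_left γ hτ.ne']
    have : 0 ≤ 1 / γ - τ := by linarith
    positivity
  rw [hx', hy']
  refine le_trans ?_ (mul_le_mul_of_nonneg_right (le_max_right _ _) hQ0)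
  have e : lam * c / K * cpForm γ τ (xb + dx) (yb + dy) ≤
      lam * c * (‖q‖ ^ 2 + ‖dx‖ ^ 2 + ‖xb‖ ^ 2) := by
    rw [div_mul_eq_mul_div, div_le_iff₀ hK0, mul_assoc (lam * c)]
    refine mul_le_mul_of_nonneg_left ?_ (by positivity)
    exact hbound.trans_eq (mul_comm _ _)
  linarith

end ChambollePock

lemma cauchySeq_of_norm_sq_le_geometric {E : Type*} [NormedAddCommGroup E] {f : ℕ → E} {C κ : ℝ}
    (hκ0 : 0 ≤ κ) (hκ1 : κ < 1) (h : ∀ k, ‖f (k + 1) - f k‖ ^ 2 ≤ C * κ ^ k) : CauchySeq f := by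
  refine cauchySeq_of_le_geometric (√κ) (√C) ((Real.sqrt_lt' one_pos).2 (by simpa)) fun k => ?_
  rw [dist_comm, dist_eq_norm]
  refine (Real.le_sqrt_of_sq_le (h k)).trans_eq ?_
  have hk : √(κ ^ k) = √κ ^ k := by
    rw [Real.sqrt_eq_iff_mul_self_eq (by positivity) (by positivity), ← mul_pow,
      Real.mul_self_sqrt hκ0]
  rw [Real.sqrt_mul' _ (by positivity), hk]

section EbersMoll

variable {a b V₁ V₂ D₁ D₂ : ℝ}

/-- If `V₁` and the first current component have opposite signs, then the second component is at
least as large as the first, and its sign agrees with that of `V₂`. -/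
lemma ebersMoll_sign (ha : 0 ≤ a) (ha1 : a ≤ 1) (hb1 : b ≤ 1)
    (h₁ : 0 ≤ D₁ * V₁) (h₂ : 0 ≤ D₂ * V₂) (hn : V₁ * (D₁ - a * D₂) < 0) :
    0 ≤ V₂ * (D₂ - b * D₁) ∧ (D₁ - a * D₂) ^ 2 ≤ (D₂ - b * D₁) ^ 2 := by
  rcases lt_trichotomy V₁ 0 with hV | hV | hV
  · have hD : D₁ ≤ 0 := nonpos_of_mul_nonneg_left h₁ hV
    have hh : 0 < D₁ - a * D₂ := pos_of_mul_neg_right hn hV.le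
    have hD2 : D₂ < 0 := by
      by_contra! h
      nlinarith
    have hV2 : V₂ ≤ 0 := by
      by_contra! h
      nlinarith
    have h3 : D₁ - a * D₂ ≤ -(D₂ - b * D₁) := by nlinarith
    exact ⟨by nlinarith, by nlinarith⟩
  · simp [hV] at hn
  · have hD : 0 ≤ D₁ := nonneg_of_mul_nonneg_left h₁ hV
    have hh : D₁ - a * D₂ < 0 := neg_of_mul_neg_right hn hV.le
    have hD2 : 0 < D₂ := by
      by_contra! h
      nlinarith
    have hV2 : 0 ≤ V₂ := by
      by_contra! h
      nlinarith
    have h3 : -(D₁ - a * D₂) ≤ (D₂ - b * D₁) := by nlinarith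
    exact ⟨by nlinarith, by nlinarith⟩

/-- A quadratic form with vanishing discriminant dominates when at most one of the two products
is negative. -/
lemma quadratic_nonneg_of_sign {m V₁ V₂ h₁ h₂ : ℝ} (hm : 0 < m) (hm2 : 4 * m * (1 + m) = 1)
    (hV : 0 ≤ V₂ * h₂) (hh : h₁ ^ 2 ≤ h₂ ^ 2) :
    0 ≤ V₁ * (h₁ + V₁) + V₂ * (h₂ + V₂) + m * ((h₁ + V₁) ^ 2 + (h₂ + V₂) ^ 2) := by
  have e : 0 ≤ ((1 + 2 * m) * V₁ + 4 * m * h₁) ^ 2 := sq_nonneg _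
  have e' : ((1 + 2 * m) * V₁ + 4 * m * h₁) ^ 2 =
      8 * m * ((1 + m) * V₁ ^ 2 + (1 + 2 * m) * (V₁ * h₁) + 2 * m * h₁ ^ 2) := by
    linear_combination (-V₁ ^ 2) * hm2
  rw [e'] at e
  have e2 := nonneg_of_mul_nonneg_right e (by positivity)
  have e3 := mul_le_mul_of_nonneg_left hh hm.le
  have e4 : 0 ≤ (1 + m) * V₂ ^ 2 := by positivity
  have e5 : 0 ≤ (1 + 2 * m) * (V₂ * h₂) := by positivity
  linarith

/-- The Ebers–Moll operator plus the identity is `-m`-comonotone for `4m(1+m) = 1`. -/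
lemma ebersMoll_comonotone_s18 {m : ℝ} (hm : 0 < m) (hm2 : 4 * m * (1 + m) = 1)
    (ha : 0 ≤ a) (ha1 : a ≤ 1) (hb : 0 ≤ b) (hb1 : b ≤ 1)
    (h₁ : 0 ≤ D₁ * V₁) (h₂ : 0 ≤ D₂ * V₂) :
    0 ≤ V₁ * (D₁ - a * D₂ + V₁) + V₂ * (D₂ - b * D₁ + V₂) +
      m * ((D₁ - a * D₂ + V₁) ^ 2 + (D₂ - b * D₁ + V₂) ^ 2) := by
  by_cases hn₁ : V₁ * (D₁ - a * D₂) < 0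
  · obtain ⟨hs, hl⟩ := ebersMoll_sign ha ha1 hb1 h₁ h₂ hn₁
    exact quadratic_nonneg_of_sign hm hm2 hs hl
  by_cases hn₂ : V₂ * (D₂ - b * D₁) < 0
  · obtain ⟨hs, hl⟩ := ebersMoll_sign hb hb1 ha1 h₂ h₁ hn₂
    have := quadratic_nonneg_of_sign (V₁ := V₂) hm hm2 hs hl
    linarith
  push Not at hn₁ hn₂
  nlinarith [sq_nonneg V₁, sq_nonneg V₂, sq_nonneg (D₁ - a * D₂ + V₁),
    sq_nonneg (D₂ - b * D₁ + V₂)]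

/-- The inverse of the Ebers–Moll operator plus the identity is Lipschitz. -/
lemma ebersMoll_inverse_lipschitz (ha : 0 ≤ a) (ha1 : a < 1) (hb : 0 ≤ b) (hb1 : b < 1)
    (h₁ : 0 ≤ D₁ * V₁) (h₂ : 0 ≤ D₂ * V₂) :
    V₁ ^ 2 + V₂ ^ 2 ≤ (2 + 16 / (2 - a - b) ^ 2 * 4) *
      ((D₁ - a * D₂ + V₁) ^ 2 + (D₂ - b * D₁ + V₂) ^ 2) := by
  obtain ⟨g₁, hg₁⟩ : ∃ g, g = D₁ - a * D₂ + V₁ := ⟨_, rfl⟩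
  obtain ⟨g₂, hg₂⟩ : ∃ g, g = D₂ - b * D₁ + V₂ := ⟨_, rfl⟩
  rw [← hg₁, ← hg₂]
  obtain ⟨t, ht⟩ : ∃ t, t = 2 - a - b := ⟨_, rfl⟩
  have ht0 : 0 < t := by linarith
  have hD : t * (D₁ ^ 2 + D₂ ^ 2) ≤ 2 * (D₁ * g₁ + D₂ * g₂) := by
    have e : 2 * (D₁ * g₁ + D₂ * g₂) = t * (D₁ ^ 2 + D₂ ^ 2) + (a + b) * (D₁ - D₂) ^ 2
        + 2 * (D₁ * V₁) + 2 * (D₂ * V₂) := by rw [hg₁, hg₂, ht]; ring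
    have : 0 ≤ (a + b) * (D₁ - D₂) ^ 2 := by positivity
    linarith
  have hD2 : t ^ 2 * (D₁ ^ 2 + D₂ ^ 2) ≤ 4 * (g₁ ^ 2 + g₂ ^ 2) := by
    have := mul_le_mul_of_nonneg_left hD ht0.le
    nlinarith [sq_nonneg (t * D₁ - 2 * g₁), sq_nonneg (t * D₂ - 2 * g₂)]
  have hV : V₁ ^ 2 + V₂ ^ 2 ≤ 2 * (g₁ ^ 2 + g₂ ^ 2) + 16 * (D₁ ^ 2 + D₂ ^ 2) := by
    have e1 : V₁ = g₁ - (D₁ - a * D₂) := by rw [hg₁]; ring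
    have e2 : V₂ = g₂ - (D₂ - b * D₁) := by rw [hg₂]; ring
    have f1 : (D₁ - a * D₂) ^ 2 ≤ 2 * (D₁ ^ 2 + D₂ ^ 2) := by
      nlinarith [sq_nonneg (D₁ + a * D₂), mul_nonneg (sub_nonneg.2 (show a ^ 2 ≤ 1 by nlinarith))
        (sq_nonneg D₂), sq_nonneg D₁]
    have f2 : (D₂ - b * D₁) ^ 2 ≤ 2 * (D₁ ^ 2 + D₂ ^ 2) := by
      nlinarith [sq_nonneg (D₂ + b * D₁), mul_nonneg (sub_nonneg.2 (show b ^ 2 ≤ 1 by nlinarith))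
        (sq_nonneg D₁), sq_nonneg D₂]
    rw [e1, e2]
    nlinarith [sq_nonneg (g₁ + (D₁ - a * D₂)), sq_nonneg (g₂ + (D₂ - b * D₁)), sq_nonneg D₁,
      sq_nonneg D₂]
  rw [← ht]
  have hD3 : D₁ ^ 2 + D₂ ^ 2 ≤ 4 * (g₁ ^ 2 + g₂ ^ 2) / t ^ 2 := by
    rw [le_div_iff₀ (by positivity)]
    linarith
  calc V₁ ^ 2 + V₂ ^ 2 ≤ 2 * (g₁ ^ 2 + g₂ ^ 2) + 16 * (4 * (g₁ ^ 2 + g₂ ^ 2) / t ^ 2) := by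
        linarith
    _ = _ := by ring

end EbersMoll

lemma tendsto_of_relaxed_step {E : Type*} [NormedAddCommGroup E] [NormedSpace ℝ E]
    {f g : ℕ → E} {x : E} {lam : ℝ} (hlam : lam ≠ 0)
    (hf : Filter.Tendsto f Filter.atTop (nhds x))
    (h : ∀ k, f (k + 1) = f k + lam • (g k - f k)) :
    Filter.Tendsto g Filter.atTop (nhds x) := by
  have e : g = fun k => f k + lam⁻¹ • (f (k + 1) - f k) := by
    ext1 k
    rw [h, add_sub_cancel_left, inv_smul_smul₀ hlam, add_sub_cancel]
  rw [e]
  simpa using hf.add (((hf.comp (Filter.tendsto_add_atTop_nat 1)).sub hf).const_smul lam⁻¹)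

section Transistor

open Filter Topology

variable {aR aF r : ℝ} {TD : ℝ → Set ℝ}

lemma mem_TNPNr_iff {v w : EuclideanSpace ℝ (Fin 2)} :
    w ∈ TNPNr aR aF TD r v ↔ ∃ u₁ ∈ TD (v 0), ∃ u₂ ∈ TD (v 1),
      w 0 = u₁ - aR * u₂ + v 0 / r ∧ w 1 = u₂ - aF * u₁ + v 1 / r := by
  constructor
  · rintro ⟨_, ⟨u₁, h₁, u₂, h₂, rfl⟩, rfl⟩
    refine ⟨u₁, h₁, u₂, h₂, ?_, ?_⟩ <;>
      simp [applyEM] <;> ring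
  · rintro ⟨u₁, h₁, u₂, h₂, e₁, e₂⟩
    refine ⟨_, ⟨u₁, h₁, u₂, h₂, rfl⟩, ?_⟩
    ext j
    fin_cases j
    · simp [applyEM, e₁]
      ring
    · simp [applyEM, e₂]
      ring

/-- Increments of `TNPNr` in coordinates, with the sign conditions coming from the diode law. -/
lemma exists_TNPNr_increment (hTD : MonotoneSetValued TD) (hr : 0 < r)
    {v v' w w' : EuclideanSpace ℝ (Fin 2)} (hw : w ∈ TNPNr aR aF TD r v)
    (hw' : w' ∈ TNPNr aR aF TD r v') :
    ∃ D₁ D₂ : ℝ, 0 ≤ D₁ * ((v - v') 0 / r) ∧ 0 ≤ D₂ * ((v - v') 1 / r) ∧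
      (w - w') 0 = D₁ - aR * D₂ + (v - v') 0 / r ∧
      (w - w') 1 = D₂ - aF * D₁ + (v - v') 1 / r := by
  obtain ⟨u₁, h₁, u₂, h₂, e₁, e₂⟩ := mem_TNPNr_iff.1 hw
  obtain ⟨u₁', h₁', u₂', h₂', e₁', e₂'⟩ := mem_TNPNr_iff.1 hw'
  refine ⟨u₁ - u₁', u₂ - u₂', ?_, ?_, ?_, ?_⟩
  · rw [← mul_div_assoc]
    exact div_nonneg (hTD h₁ h₁') hr.le
  · rw [← mul_div_assoc]
    exact div_nonneg (hTD h₂ h₂') hr.le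
  · rw [PiLp.sub_apply, PiLp.sub_apply, e₁, e₁']
    ring
  · rw [PiLp.sub_apply, PiLp.sub_apply, e₂, e₂']
    ring

lemma TNPNr_comonotone (haR : aR ∈ Set.Ico (0 : ℝ) 1) (haF : aF ∈ Set.Ico (0 : ℝ) 1)
    (hTD : MonotoneSetValued TD) (hr : 0 < r) {v v' w w' : EuclideanSpace ℝ (Fin 2)}
    (hw : w ∈ TNPNr aR aF TD r v) (hw' : w' ∈ TNPNr aR aF TD r v') :
    -(r * (√2 - 1) / 2) * ‖w - w'‖ ^ 2 ≤ ⟪v - v', w - w'⟫_ℝ := by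
  obtain ⟨D₁, D₂, h₁, h₂, e₁, e₂⟩ := exists_TNPNr_increment hTD hr hw hw'
  have h2 : (1 : ℝ) < √2 := Real.lt_sqrt_of_sq_lt (by norm_num)
  have hsq : √2 ^ 2 = (2 : ℝ) := Real.sq_sqrt (by norm_num)
  have key := ebersMoll_comonotone_s18 (m := (√2 - 1) / 2) (by linarith) (by linear_combination hsq)
    haR.1 haR.2.le haF.1 haF.2.le h₁ h₂
  rw [← e₁, ← e₂] at key
  have := mul_nonneg hr.le key
  rw [EuclideanSpace.real_norm_sq_eq, PiLp.inner_apply, Fin.sum_univ_two, Fin.sum_univ_two]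
  simp only [RCLike.inner_apply, conj_trivial]
  field_simp at this
  linarith

lemma exists_TNPNr_inverse_lipschitz (haR : aR ∈ Set.Ico (0 : ℝ) 1)
    (haF : aF ∈ Set.Ico (0 : ℝ) 1) (hTD : MonotoneSetValued TD) (hr : 0 < r) :
    ∃ L : ℝ, 0 ≤ L ∧ ∀ v v' w w' : EuclideanSpace ℝ (Fin 2), w ∈ TNPNr aR aF TD r v →
      w' ∈ TNPNr aR aF TD r v' → ‖v - v'‖ ^ 2 ≤ L * ‖w - w'‖ ^ 2 := by
  refine ⟨r ^ 2 * (2 + 16 / (2 - aR - aF) ^ 2 * 4), by positivity, fun v v' w w' hw hw' => ?_⟩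
  obtain ⟨D₁, D₂, h₁, h₂, e₁, e₂⟩ := exists_TNPNr_increment hTD hr hw hw'
  have key := ebersMoll_inverse_lipschitz haR.1 haR.2 haF.1 haF.2 h₁ h₂
  rw [← e₁, ← e₂] at key
  have := mul_le_mul_of_nonneg_left key (sq_nonneg r)
  rw [EuclideanSpace.real_norm_sq_eq, EuclideanSpace.real_norm_sq_eq, Fin.sum_univ_two,
    Fin.sum_univ_two, mul_assoc]
  refine le_trans (le_of_eq ?_) this
  field_simp

lemma tendsto_apply {f : ℕ → EuclideanSpace ℝ (Fin 2)} {x : EuclideanSpace ℝ (Fin 2)}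
    (h : Tendsto f atTop (𝓝 x)) (j : Fin 2) : Tendsto (fun k => f k j) atTop (𝓝 (x j)) :=
  ((EuclideanSpace.proj (𝕜 := ℝ) j).continuous.tendsto x).comp h

/-- The graph of `TNPNr` is sequentially closed. -/
lemma mem_TNPNr_of_tendsto (haR : aR ∈ Set.Ico (0 : ℝ) 1) (haF : aF ∈ Set.Ico (0 : ℝ) 1)
    (hTDosc : IsClosed {p : ℝ × ℝ | p.2 ∈ TD p.1}) {v w : ℕ → EuclideanSpace ℝ (Fin 2)}
    {v' w' : EuclideanSpace ℝ (Fin 2)} (hv : Tendsto v atTop (𝓝 v'))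
    (hw : Tendsto w atTop (𝓝 w')) (h : ∀ k, w k ∈ TNPNr aR aF TD r (v k)) :
    w' ∈ TNPNr aR aF TD r v' := by
  have hdet : 1 - aR * aF ≠ 0 := by nlinarith [haR.1, haR.2, haF.1, haF.2]
  choose u₁ h₁ u₂ h₂ e₁ e₂ using fun k => mem_TNPNr_iff.1 (h k)
  have t₁ := (tendsto_apply hw 0).sub ((tendsto_apply hv 0).div_const r)
  have t₂ := (tendsto_apply hw 1).sub ((tendsto_apply hv 1).div_const r)
  have l₁ := (t₁.add (t₂.const_mul aR)).div_const (1 - aR * aF)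
  have l₂ := (t₂.add (t₁.const_mul aF)).div_const (1 - aR * aF)
  have hu₁ : (fun k => (w k 0 - v k 0 / r + aR * (w k 1 - v k 1 / r)) / (1 - aR * aF)) = u₁ := by
    ext k
    rw [e₁, e₂, div_eq_iff hdet]
    ring
  have hu₂ : (fun k => (w k 1 - v k 1 / r + aF * (w k 0 - v k 0 / r)) / (1 - aR * aF)) = u₂ := by
    ext k
    rw [e₁, e₂, div_eq_iff hdet]
    ring
  rw [hu₁] at l₁
  rw [hu₂] at l₂
  refine mem_TNPNr_iff.2 ⟨_, hTDosc.mem_of_tendsto ((tendsto_apply hv 0).prodMk_nhds l₁)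
    (Eventually.of_forall h₁), _, hTDosc.mem_of_tendsto ((tendsto_apply hv 1).prodMk_nhds l₂)
    (Eventually.of_forall h₂), ?_, ?_⟩
  · exact tendsto_nhds_unique (tendsto_apply hw 0) (((l₁.sub (l₂.const_mul aR)).add
      ((tendsto_apply hv 0).div_const r)).congr fun k => (e₁ k).symm)
  · exact tendsto_nhds_unique (tendsto_apply hw 1) (((l₂.sub (l₁.const_mul aF)).add
      ((tendsto_apply hv 1).div_const r)).congr fun k => (e₂ k).symm)

end Transistor

theorem stmt_18 (aR aF : ℝ) (haR : aR ∈ Set.Ico (0 : ℝ) 1) (haF : aF ∈ Set.Ico (0 : ℝ) 1)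
    (TD : ℝ → Set ℝ) (hTD : MonotoneSetValued TD)
    (hTDosc : IsClosed {p : ℝ × ℝ | p.2 ∈ TD p.1})
    (r : ℝ) (hr : r > 0)
    (RC RE : ℝ → ℝ)
    (hRCosc : IsClosed {p : ℝ × ℝ | p.2 = RC p.1})
    (hREosc : IsClosed {p : ℝ × ℝ | p.2 = RE p.1})
    (σ : ℝ) (hσ : σ > r * (Real.sqrt 2 - 1) / 2)
    (hRCmono : ∀ x y : ℝ, (x - y) * (RC x - RC y) ≥ σ * (x - y) ^ 2)
    (hREmono : ∀ x y : ℝ, (x - y) * (RE x - RE y) ≥ σ * (x - y) ^ 2)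
    (s : EuclideanSpace ℝ (Fin 2))
    -- `R̃(i₁,i₂) := (R_C(i₁) + s₁, R_E(i₂) + s₂)`
    (Rtil : EuclideanSpace ℝ (Fin 2) → EuclideanSpace ℝ (Fin 2))
    (hRtil : ∀ x, Rtil x =
      (WithLp.equiv 2 (Fin 2 → ℝ)).symm ![RC (x 0) + s 0, RE (x 1) + s 1])
    -- `G̃ := T_NPN + (1/r)·id`
    (Gtil : EuclideanSpace ℝ (Fin 2) → Set (EuclideanSpace ℝ (Fin 2)))
    (hGtil : Gtil = TNPNr aR aF TD r)
    (τ γ lam : ℝ)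
    (hτ : τ > -(σ * r * (1 - Real.sqrt 2)) / (r * (1 - Real.sqrt 2) + 2 * σ))
    (hγ : γ ∈ Set.Ioo 0 (1 / τ))
    (hlam : lam ∈ Set.Ioo 0
      (2 * (1 - (-(σ * r * (1 - Real.sqrt 2)) / (r * (1 - Real.sqrt 2) + 2 * σ)) / τ)))
    (i v ibar vbar : ℕ → EuclideanSpace ℝ (Fin 2))
    -- `ī^k ∈ J_{γR̃}(i^k − γv^k)`
    (hstep1 : ∀ k : ℕ, i k - γ • v k = ibar k + γ • Rtil (ibar k))
    -- `v̄^k ∈ J_{τG̃}(v^k + τ(2ī^k − i^k))`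
    (hstep2 : ∀ k : ℕ, ∃ w ∈ Gtil (vbar k),
      v k + τ • (2 • ibar k - i k) = vbar k + τ • w)
    (hstep3 : ∀ k : ℕ, i (k + 1) = i k + lam • (ibar k - i k))
    (hstep4 : ∀ k : ℕ, v (k + 1) = v k + lam • (vbar k - v k)) :
    ∃ istar vstar : EuclideanSpace ℝ (Fin 2),
      Filter.Tendsto (fun k => (i k, v k)) Filter.atTop (nhds (istar, vstar)) ∧
      Rtil istar + vstar = 0 ∧ istar ∈ Gtil vstar := by
  subst hGtil
  set μ := r * (√2 - 1) / 2 with hμdef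
  have hsqrt : (1 : ℝ) < √2 := Real.lt_sqrt_of_sq_lt (by norm_num)
  have hμ : 0 < μ := by
    have : 0 < √2 - 1 := by linarith
    positivity
  have hσμ : 0 < σ - μ := sub_pos.2 hσ
  have hβ : -(σ * r * (1 - √2)) / (r * (1 - √2) + 2 * σ) = σ * μ / (σ - μ) := by
    have hd : r * (1 - √2) + 2 * σ = 2 * (σ - μ) := by rw [hμdef]; ring
    have hn : -(σ * r * (1 - √2)) = 2 * (σ * μ) := by rw [hμdef]; ring
    rw [hd, hn, mul_div_mul_left _ _ two_ne_zero]
  rw [hβ] at hτ hlam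
  have hτ0 : 0 < τ := lt_trans (div_pos (mul_pos (hμ.trans hσ) hμ) hσμ) hτ
  obtain ⟨hγ0, hγ1⟩ := hγ
  have hγτ : τ < 1 / γ := (lt_one_div hτ0 hγ0).2 hγ1
  obtain ⟨hlam0, hlam1⟩ := hlam
  obtain ⟨L, hL, hLip⟩ := exists_TNPNr_inverse_lipschitz haR haF hTD hr
  obtain ⟨κ, hκ0, hκ1, hcontr⟩ := exists_cpForm_contraction
    (E := EuclideanSpace ℝ (Fin 2)) hμ hσ hL hτ0 hγτ hlam0 hlam1
  choose w hw hwe using hstep2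
  have hR : ∀ k, Rtil (ibar k) = γ⁻¹ • (i k - ibar k) - v k := by
    intro k
    have e : i k - ibar k = γ • (Rtil (ibar k) + v k) := by
      rw [smul_add, ← sub_eq_iff_eq_add.2 ((hstep1 k).trans (add_comm _ _))]
      abel
    rw [e, inv_smul_smul₀ hγ0.ne', add_sub_cancel_right]
  have hG : ∀ k, w k = τ⁻¹ • (v k - vbar k) + (2 • ibar k - i k) := by
    intro k
    have e : v k - vbar k = τ • (w k - (2 • ibar k - i k)) := by
      rw [smul_sub, ← sub_eq_iff_eq_add.2 ((hwe k).trans (add_comm _ _))]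
      abel
    rw [e, inv_smul_smul₀ hτ0.ne', sub_add_cancel]
  have hRmono : ∀ x y, σ * ‖x - y‖ ^ 2 ≤ ⟪x - y, Rtil x - Rtil y⟫_ℝ := by
    intro x y
    rw [EuclideanSpace.real_norm_sq_eq, PiLp.inner_apply, Fin.sum_univ_two, Fin.sum_univ_two,
      hRtil, hRtil]
    simp only [RCLike.inner_apply, conj_trivial, PiLp.sub_apply, WithLp.equiv_symm_apply,
      Matrix.cons_val_zero, Matrix.cons_val_one]
    linarith [hRCmono (x 0) (y 0), hREmono (x 1) (y 1)]
  have hdecay : ∀ k, cpForm γ τ (i (k + 1) - i k) (v (k + 1) - v k) ≤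
      cpForm γ τ (i 1 - i 0) (v 1 - v 0) * κ ^ k := by
    intro k
    induction k with
    | zero => simp
    | succ k ih =>
      have h := hcontr (i (k + 1) - i k) (v (k + 1) - v k) (ibar (k + 1) - ibar k)
        (vbar (k + 1) - vbar k) (Rtil (ibar (k + 1)) - Rtil (ibar k)) (w (k + 1) - w k)
        (by rw [hR, hR]; module) (by rw [hG, hG]; module) (hRmono _ _)
        (TNPNr_comonotone haR haF hTD hr (hw _) (hw _)) (hLip _ _ _ _ (hw _) (hw _))
      have ei : i (k + 1) - i k + lam • (ibar (k + 1) - ibar k - (i (k + 1) - i k)) =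
          i (k + 1 + 1) - i (k + 1) := by
        rw [hstep3 (k + 1), hstep3 k]
        module
      have ev : v (k + 1) - v k + lam • (vbar (k + 1) - vbar k - (v (k + 1) - v k)) =
          v (k + 1 + 1) - v (k + 1) := by
        rw [hstep4 (k + 1), hstep4 k]
        module
      rw [ei, ev] at h
      refine h.trans ((mul_le_mul_of_nonneg_left ih hκ0).trans_eq ?_)
      ring
  have hγτ' : 0 < 1 / γ - τ := sub_pos.2 hγτ
  have hτγ' : 0 < 1 / τ - γ := sub_pos.2 hγ1
  have hci : CauchySeq i := by
    refine cauchySeq_of_norm_sq_le_geometric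
      (C := cpForm γ τ (i 1 - i 0) (v 1 - v 0) / (1 / γ - τ)) hκ0 hκ1 fun k => ?_
    have h := hdecay k
    rw [cpForm_eq_left γ hτ0.ne'] at h
    rw [div_mul_eq_mul_div, le_div_iff₀ hγτ', mul_comm]
    exact le_trans (le_add_of_nonneg_left (by positivity)) h
  have hcv : CauchySeq v := by
    refine cauchySeq_of_norm_sq_le_geometric
      (C := cpForm γ τ (i 1 - i 0) (v 1 - v 0) / (1 / τ - γ)) hκ0 hκ1 fun k => ?_
    have h := hdecay k
    rw [cpForm_eq_right hγ0.ne'] at h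
    rw [div_mul_eq_mul_div, le_div_iff₀ hτγ', mul_comm]
    exact le_trans (le_add_of_nonneg_left (by positivity)) h
  obtain ⟨istar, hi⟩ := cauchySeq_tendsto_of_complete hci
  obtain ⟨vstar, hv⟩ := cauchySeq_tendsto_of_complete hcv
  have hib : Filter.Tendsto ibar Filter.atTop (nhds istar) :=
    tendsto_of_relaxed_step hlam0.ne' hi hstep3
  have hvb : Filter.Tendsto vbar Filter.atTop (nhds vstar) :=
    tendsto_of_relaxed_step hlam0.ne' hv hstep4
  refine ⟨istar, vstar, hi.prodMk_nhds hv, ?_, ?_⟩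
  · have hRlim : Filter.Tendsto (fun k => Rtil (ibar k)) Filter.atTop (nhds (-vstar)) := by
      simp_rw [hR]
      simpa using ((hi.sub hib).const_smul γ⁻¹).sub hv
    have l₀ : Filter.Tendsto (fun k => RC (ibar k 0)) Filter.atTop (nhds (-vstar 0 - s 0)) := by
      simpa [hRtil] using (tendsto_apply hRlim 0).sub_const (s 0)
    have l₁ : Filter.Tendsto (fun k => RE (ibar k 1)) Filter.atTop (nhds (-vstar 1 - s 1)) := by
      simpa [hRtil] using (tendsto_apply hRlim 1).sub_const (s 1)
    have e₀ : -vstar 0 - s 0 = RC (istar 0) :=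
      hRCosc.mem_of_tendsto ((tendsto_apply hib 0).prodMk_nhds l₀)
        (Filter.Eventually.of_forall fun _ => rfl)
    have e₁ : -vstar 1 - s 1 = RE (istar 1) :=
      hREosc.mem_of_tendsto ((tendsto_apply hib 1).prodMk_nhds l₁)
        (Filter.Eventually.of_forall fun _ => rfl)
    rw [hRtil, ← e₀, ← e₁]
    ext j
    fin_cases j <;> simp
  · refine mem_TNPNr_of_tendsto haR haF hTDosc hvb ?_ hw
    have e : τ⁻¹ • (vstar - vstar) + (2 • istar - istar) = istar := by module
    rw [← e, funext hG]
    exact ((hv.sub hvb).const_smul _).add ((hib.const_smul 2).sub hi)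
end
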